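/- For every m ≥ 2, every γ₁, δ₁ with γ₁+2δ₁ = 2m+2 and δ₁ ≥ 1, and every γ, δ with m+1 ≤ δ ≤ δ₁+m and max(0, γ₁+δ₁−δ) ≤ γ ≤ γ₁+δ₁−δ+m, there exist two quaternary linear perfect codes C₁ and C₂ of length 2^(2m), of dual type (0,2^(2m);γ₁,δ₁) and (0,2^(2m);0,m+1) respectively, such that C₁ ∩ C₂ is of dual type (0,2^(2m);γ,δ). -/

import Mathlib

open scoped BigOperators

/-- `Z2` is the ring of integers modulo 2. -/
abbrev Z2 : Type := ZMod 2

/-- `Z4` is the ring of integers modulo 4. -/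
abbrev Z4 : Type := ZMod 4

/-- The ambient group `Z₂^α × Z₄^β` for additive codes. -/
abbrev Amb (α β : ℕ) : Type := (Fin α → Z2) × (Fin β → Z4)

/-- The inner product on `Z₂^α × Z₄^β`:
`⟨u,v⟩ = 2·(Σᵢ ūᵢ·v̄ᵢ) + Σⱼ uⱼ·vⱼ ∈ Z₄`, where the bar denotes the lift `0 ↦ 0`, `1 ↦ 1`
of binary coordinates into `Z₄`. -/
def addInner {α β : ℕ} (u v : Amb α β) : Z4 :=
  2 * (∑ i, ((u.1 i).val : Z4) * ((v.1 i).val : Z4)) + ∑ j, u.2 j * v.2 j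

lemma addInner_zero_left {α β : ℕ} (v : Amb α β) : addInner 0 v = 0 := by
  simp [addInner]

lemma addInner_add_left {α β : ℕ} (u u' v : Amb α β) :
    addInner (u + u') v = addInner u v + addInner u' v := by
  have key : ∀ x x' y : Z2,
      (2 : Z4) * ((((x + x').val : ℕ) : Z4) * ((y.val : ℕ) : Z4)) =
        2 * (((x.val : ℕ) : Z4) * ((y.val : ℕ) : Z4)) +
          2 * (((x'.val : ℕ) : Z4) * ((y.val : ℕ) : Z4)) := by decide
  simp only [addInner, Prod.fst_add, Prod.snd_add, Pi.add_apply, add_mul,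
    Finset.mul_sum, Finset.sum_add_distrib]
  rw [Finset.sum_congr rfl (fun i _ => key (u.1 i) (u'.1 i) (v.1 i)),
    Finset.sum_add_distrib]
  ring

lemma addInner_neg_left {α β : ℕ} (u v : Amb α β) :
    addInner (-u) v = - addInner u v := by
  have hn : ∀ x : Z2, (-x) = x := by decide
  have key : ∀ S T : Z4, 2 * S + -T = -(2 * S + T) := by decide
  simp only [addInner, Prod.fst_neg, Prod.snd_neg, Pi.neg_apply, hn, neg_mul]
  rw [Finset.sum_neg_distrib]
  exact key _ _

/-- The additive dual `C^⊥ = {u : ⟨u,v⟩ = 0 for all v ∈ C}` of an additive code `C`. -/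
def dualCode {α β : ℕ} (C : AddSubgroup (Amb α β)) : AddSubgroup (Amb α β) where
  carrier := {u | ∀ v ∈ C, addInner u v = 0}
  zero_mem' := fun v _ => addInner_zero_left v
  add_mem' := by
    intro a b ha hb v hv
    rw [addInner_add_left, ha v hv, hb v hv, add_zero]
  neg_mem' := by
    intro a ha v hv
    rw [addInner_neg_left, ha v hv, neg_zero]

/-- An additive code `C ⊆ Z₂^α × Z₄^β` is of type `(α,β;γ,δ)` when it is isomorphic,
as an abelian group, to `Z₂^γ × Z₄^δ`; equivalently (which is how we state it),
`|C| = 2^(γ+2δ)` and the number of elements `x ∈ C` with `x + x = 0` is `2^(γ+δ)`. -/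
def isOfType {α β : ℕ} (C : AddSubgroup (Amb α β)) (γ δ : ℕ) : Prop :=
  Nat.card C = 2 ^ (γ + 2 * δ) ∧
    Nat.card {x : Amb α β // x ∈ C ∧ x + x = 0} = 2 ^ (γ + δ)

/-- An additive code `C` is of type `(α,β;γ,δ;κ)` when it is of type `(α,β;γ,δ)` and
`2^κ` is the cardinality of the image of `{x ∈ C : x + x = 0}` under the projection
onto the binary coordinates. -/
def isOfTypeK {α β : ℕ} (C : AddSubgroup (Amb α β)) (γ δ κ : ℕ) : Prop :=
  isOfType C γ δ ∧
    Nat.card ↥(Prod.fst '' {x : Amb α β | x ∈ C ∧ x + x = 0}) = 2 ^ κ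

/-- The Gray map on one quaternary coordinate:
`0 ↦ (0,0)`, `1 ↦ (0,1)`, `2 ↦ (1,1)`, `3 ↦ (1,0)`. -/
def grayPhi (y : Z4) : Z2 × Z2 :=
  if y = 0 then (0, 0) else if y = 1 then (0, 1) else if y = 2 then (1, 1) else (1, 0)

/-- The Gray map `Φ : Z₂^α × Z₄^β → Z₂^(α+2β)` (with index set `Fin α ⊕ Fin β × Fin 2`),
acting as the identity on the binary coordinates and as `grayPhi` coordinatewise on the
quaternary coordinates. -/
def grayMap {α β : ℕ} (u : Amb α β) : (Fin α ⊕ Fin β × Fin 2) → Z2 :=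
  Sum.elim (fun a => u.1 a)
    (fun b => if b.2 = 0 then (grayPhi (u.2 b.1)).1 else (grayPhi (u.2 b.1)).2)

/-- The minimum Hamming distance of a binary code `S` equals `d`. -/
def minDistEq {ι : Type} [Fintype ι] (S : Set (ι → Z2)) (d : ℕ) : Prop :=
  (∀ x ∈ S, ∀ y ∈ S, x ≠ y → d ≤ hammingDist x y) ∧
    ∃ x ∈ S, ∃ y ∈ S, x ≠ y ∧ hammingDist x y = d

/-- A quaternary linear perfect code of length `β = 2^(t-1)` (`t ≥ 3`): an additive
subgroup of `Z₄^β` whose Gray image has cardinality `2^(2β-t-1)` and minimum Hamming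
distance `4`. -/
def isQuatPerfect (t β : ℕ) (C : AddSubgroup (Amb 0 β)) : Prop :=
  3 ≤ t ∧ β = 2 ^ (t - 1) ∧
    Nat.card ↥(grayMap '' (C : Set (Amb 0 β))) = 2 ^ (2 * β - t - 1) ∧
    minDistEq (grayMap '' (C : Set (Amb 0 β))) 4

/-- An additive extended perfect code with `α ≠ 0` and binary length `α + 2β = 2^t`:
an additive subgroup of `Z₂^α × Z₄^β` with `α ≥ 1` whose Gray image has cardinality
`2^(2^t - t - 1)` and minimum Hamming distance `4`. -/
def isAddExtPerfect (t α β : ℕ) (C : AddSubgroup (Amb α β)) : Prop :=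
  1 ≤ α ∧ α + 2 * β = 2 ^ t ∧
    Nat.card ↥(grayMap '' (C : Set (Amb α β))) = 2 ^ (2 ^ t - t - 1) ∧
    minDistEq (grayMap '' (C : Set (Amb α β))) 4

section Duality

variable {N : ℕ}

lemma addInner_comm (u v : Amb 0 N) : addInner u v = addInner v u := by
  simp [addInner, mul_comm]

lemma addInner_eq_sum (u v : Amb 0 N) : addInner u v = ∑ j, u.2 j * v.2 j := by
  simp [addInner]

/-- The character `x ↦ ψ ⟨x, v⟩` of the ambient group. -/
noncomputable def innerChar (v : Amb 0 N) : AddChar (Amb 0 N) ℂ where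
  toFun u := ZMod.stdAddChar (addInner u v)
  map_zero_eq_one' := by simp [addInner_zero_left]
  map_add_eq_mul' a b := by rw [addInner_add_left, AddChar.map_add_eq_mul]

lemma innerChar_apply (u v : Amb 0 N) :
    innerChar v u = ZMod.stdAddChar (addInner u v) := rfl

lemma stdAddChar_eq_one_iff (a : Z4) : ZMod.stdAddChar a = 1 ↔ a = 0 := by
  rw [← (ZMod.stdAddChar (N := 4)).map_zero_eq_one, ZMod.injective_stdAddChar.eq_iff]

lemma eq_zero_of_addInner_eq_zero {v : Amb 0 N} (h : ∀ u, addInner u v = 0) : v = 0 := by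
  ext j
  · exact j.elim0
  · have := h (0, Pi.single j 1)
    rw [addInner_eq_sum, Finset.sum_eq_single j] at this
    · simpa using this
    · intro b _ hb
      simp [hb]
    · simp

lemma card_mul_card_dualCode (D : AddSubgroup (Amb 0 N)) :
    Nat.card D * Nat.card (dualCode D) = 4 ^ N := by
  classical
  have hamb : Fintype.card (Amb 0 N) = 4 ^ N := by simp [Amb]
  have hrow (d : D) : ∑ x : Amb 0 N, innerChar d.1 x = if d = 0 then (4 ^ N : ℂ) else 0 := by
    rw [AddChar.sum_eq_ite, hamb]
    have : innerChar d.1 = 0 ↔ d = 0 := by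
      refine ⟨fun h => Subtype.ext (eq_zero_of_addInner_eq_zero fun u => ?_), fun h => ?_⟩
      · rw [← stdAddChar_eq_one_iff, ← innerChar_apply, h, AddChar.zero_apply]
      · subst h
        ext u
        simp [innerChar_apply, addInner_comm u, addInner_zero_left]
    simp [this]
  have hcol (x : Amb 0 N) : ∑ d : D, innerChar d.1 x =
      if x ∈ dualCode D then (Nat.card D : ℂ) else 0 := by
    have e (d : D) : innerChar d.1 x = (innerChar x).compAddMonoidHom D.subtype d := by
      simp [innerChar_apply, addInner_comm x]
    rw [Finset.sum_congr rfl fun d _ => e d, AddChar.sum_eq_ite, Nat.card_eq_fintype_card]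
    have : (innerChar x).compAddMonoidHom D.subtype = 0 ↔ x ∈ dualCode D := by
      constructor
      · intro h v hv
        rw [← stdAddChar_eq_one_iff, ← innerChar_apply]
        rw [e ⟨v, hv⟩, h, AddChar.zero_apply]
      · intro h
        ext d
        rw [← e, innerChar_apply, h d.1 d.2]
        simp
    simp [this]
  have key : ∑ d : D, ∑ x : Amb 0 N, innerChar d.1 x =
      ∑ x : Amb 0 N, ∑ d : D, innerChar d.1 x := Finset.sum_comm
  simp only [hrow, hcol] at key
  rw [Finset.sum_ite_eq' Finset.univ, ← Finset.sum_filter, Finset.sum_const,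
    ← Fintype.card_subtype] at key
  have h2 : Nat.card (dualCode D) = Fintype.card {x // x ∈ dualCode D} :=
    Nat.card_eq_fintype_card
  simp only [Finset.mem_univ, if_true, nsmul_eq_mul] at key
  rw [h2, mul_comm]
  exact_mod_cast key.symm

lemma le_dualCode_dualCode (D : AddSubgroup (Amb 0 N)) : D ≤ dualCode (dualCode D) :=
  fun v hv u hu => by rw [addInner_comm]; exact hu v hv

lemma dualCode_dualCode (D : AddSubgroup (Amb 0 N)) : dualCode (dualCode D) = D := by
  have h1 := card_mul_card_dualCode D
  have h2 := card_mul_card_dualCode (dualCode D)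
  have hpos : 0 < Nat.card (dualCode D) := Nat.card_pos
  have h3 : Nat.card (dualCode (dualCode D)) = Nat.card D := by
    rw [← h1, mul_comm (Nat.card D)] at h2
    exact Nat.eq_of_mul_eq_mul_left hpos h2
  exact (AddSubgroup.eq_of_le_of_card_ge (le_dualCode_dualCode D) h3.le).symm

lemma dualCode_inf_dualCode (D D' : AddSubgroup (Amb 0 N)) :
    dualCode D ⊓ dualCode D' = dualCode (D ⊔ D') := by
  ext u
  constructor
  · rintro ⟨h, h'⟩ v hv
    obtain ⟨a, ha, b, hb, rfl⟩ := AddSubgroup.mem_sup.1 hv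
    rw [addInner_comm, addInner_add_left, addInner_comm a, addInner_comm b, h a ha, h' b hb,
      add_zero]
  · intro h
    exact ⟨fun v hv => h v ((le_sup_left : D ≤ D ⊔ D') hv),
      fun v hv => h v ((le_sup_right : D' ≤ D ⊔ D') hv)⟩

end Duality

section Perfect

variable {N : ℕ}

/-- The Lee weight on `Z₄`. -/
def lee (a : Z4) : ℕ := if a = 0 then 0 else if a = 2 then 2 else 1

lemma hammingDist_grayMap (u v : Amb 0 N) :
    hammingDist (grayMap u) (grayMap v) = ∑ j, lee (u.2 j - v.2 j) := by
  have key : ∀ a b : Z4, ((if (grayPhi a).1 ≠ (grayPhi b).1 then 1 else 0) +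
      if (grayPhi a).2 ≠ (grayPhi b).2 then 1 else 0) = lee (a - b) := by decide
  rw [hammingDist, Finset.card_filter, Fintype.sum_sum_type, Fintype.sum_prod_type]
  simp only [Finset.univ_eq_empty, Finset.sum_empty, zero_add, Fin.sum_univ_two]
  refine Finset.sum_congr rfl fun j _ => ?_
  rw [← key]
  simp [grayMap]

lemma lee_pos {a : Z4} (h : a ≠ 0) : 1 ≤ lee a := by
  revert a; decide

lemma grayMap_injective : Function.Injective (grayMap : Amb 0 N → _) := by
  intro u v h
  have h0 : hammingDist (grayMap u) (grayMap v) = 0 := by rw [h, hammingDist_self]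
  rw [hammingDist_grayMap, Finset.sum_eq_zero_iff] at h0
  ext j
  · exact j.elim0
  · by_contra hne
    have := lee_pos (sub_ne_zero.2 hne)
    have := h0 j (Finset.mem_univ j)
    omega

lemma even_sum_lee {w : Fin N → Z4} (h : ∑ j, w j = 0) : Even (∑ j, lee (w j)) := by
  have key : ∀ a : Z4, 2 * (lee a : Z4) = 2 * a := by decide
  have : ((2 * ∑ j, lee (w j) : ℕ) : Z4) = 0 := by
    push_cast
    rw [Finset.mul_sum, Finset.sum_congr rfl fun j _ => key (w j), ← Finset.mul_sum, h, mul_zero]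
  rw [ZMod.natCast_eq_zero_iff] at this
  rw [even_iff_two_dvd]
  omega

lemma four_le_sum_lee {D : AddSubgroup (Amb 0 N)} (hone : (0, fun _ => 1) ∈ D)
    (hsep : ∀ i j, i ≠ j → ∃ h ∈ D, h.2 i ≠ h.2 j) {w : Amb 0 N} (hw : w ∈ dualCode D)
    (hw0 : w ≠ 0) : 4 ≤ ∑ j, lee (w.2 j) := by
  have hsum : ∑ j, w.2 j = 0 := by
    simpa [addInner_eq_sum] using hw _ hone
  have heven := even_sum_lee hsum
  obtain ⟨a, ha⟩ : ∃ a, w.2 a ≠ 0 := by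
    by_contra! h
    exact hw0 (Prod.ext (funext fun j => j.elim0) (funext h))
  obtain ⟨b, hba, hb⟩ : ∃ b, b ≠ a ∧ w.2 b ≠ 0 := by
    by_contra! h
    exact ha (by rwa [Finset.sum_eq_single a (fun b _ hb => h b hb) (by simp)] at hsum)
  by_cases hc : ∃ c, c ≠ a ∧ c ≠ b ∧ w.2 c ≠ 0
  · obtain ⟨c, hca, hcb, hc⟩ := hc
    have h3 : ∑ j ∈ {a, b, c}, lee (w.2 j) ≤ ∑ j, lee (w.2 j) :=
      Finset.sum_le_sum_of_subset (Finset.subset_univ _)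
    rw [Finset.sum_insert (by simp [hba.symm, hca.symm]), Finset.sum_insert (by simp [hcb.symm]),
      Finset.sum_singleton] at h3
    have := lee_pos ha
    have := lee_pos hb
    have := lee_pos hc
    obtain ⟨k, hk⟩ := heven
    omega
  · push Not at hc
    have hpair (M : Type) [AddCommMonoid M] (f : Fin N → M)
        (hf : ∀ c, c ≠ a ∧ c ≠ b → f c = 0) : ∑ j, f j = f a + f b :=
      Fintype.sum_eq_add a b hba.symm hf
    rw [hpair _ _ fun c h => hc c h.1 h.2] at hsum
    rw [hpair _ (fun j => lee (w.2 j)) fun c h => by simp [hc c h.1 h.2, lee]]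
    obtain ⟨h, hD, hne⟩ := hsep a b hba.symm
    have horth := hw h hD
    rw [addInner_eq_sum, hpair _ _ fun c h => by simp [hc c h.1 h.2]] at horth
    rw [eq_neg_of_add_eq_zero_right hsum] at horth ⊢
    have key : ∀ x s t : Z4, x ≠ 0 → s ≠ t → x * s + -x * t = 0 → 4 ≤ lee x + lee (-x) := by
      decide
    exact key _ _ _ ha hne horth

lemma isQuatPerfect_dualCode {m : ℕ} (hm : 2 ≤ m) {D : AddSubgroup (Amb 0 (2 ^ (2 * m)))}
    (hcard : Nat.card D = 2 ^ (2 * m + 2)) (hone : (0, fun _ => 1) ∈ D)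
    (hsep : ∀ i j, i ≠ j → ∃ h ∈ D, h.2 i ≠ h.2 j)
    (heven : ∃ i j, i ≠ j ∧ ∀ h ∈ D, 2 * h.2 i = 2 * h.2 j) :
    isQuatPerfect (2 * m + 1) (2 ^ (2 * m)) (dualCode D) := by
  refine ⟨by omega, rfl, ?_, ?_, ?_⟩
  · have h := card_mul_card_dualCode D
    rw [hcard] at h
    have hle : 2 * m + 2 ≤ 2 * 2 ^ (2 * m) := by
      have := Nat.lt_two_pow_self (n := 2 * m)
      omega
    rw [Nat.card_image_of_injective grayMap_injective]
    refine Nat.eq_of_mul_eq_mul_left (pow_pos two_pos (2 * m + 2)) ?_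
    refine h.trans ?_
    rw [← pow_add, show (4 : ℕ) = 2 ^ 2 from rfl, ← pow_mul]
    congr 1
    omega
  · rintro _ ⟨u, hu, rfl⟩ _ ⟨v, hv, rfl⟩ hne
    rw [hammingDist_grayMap]
    exact four_le_sum_lee hone hsep ((dualCode D).sub_mem hu hv)
      (sub_ne_zero.2 fun h => hne (by rw [h]))
  · obtain ⟨i, j, hij, h⟩ := heven
    have hlee : ∑ k, lee ((Pi.single i 2 + Pi.single j 2 : Fin (2 ^ (2 * m)) → Z4) k) = 4 := by
      rw [Fintype.sum_eq_add i j hij]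
      · simp only [Pi.add_apply, Pi.single_eq_same, Pi.single_eq_of_ne hij,
          Pi.single_eq_of_ne hij.symm, add_zero, zero_add]
        decide
      · rintro k ⟨h1, h2⟩
        simp [h1, h2, lee]
    have hdist : hammingDist (grayMap ((0, Pi.single i 2 + Pi.single j 2) : Amb 0 (2 ^ (2 * m))))
        (grayMap (0 : Amb 0 (2 ^ (2 * m)))) = 4 := by
      rw [hammingDist_grayMap]
      simpa only [Prod.snd_zero, Pi.zero_apply, sub_zero] using hlee
    refine ⟨_, ⟨(0, Pi.single i 2 + Pi.single j 2), ?_, rfl⟩, _, ⟨0, (dualCode D).zero_mem, rfl⟩,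
      ?_, hdist⟩
    · intro v hv
      rw [addInner_eq_sum, Fintype.sum_eq_add i j hij]
      · simp only [Pi.add_apply, Pi.single_eq_same, Pi.single_eq_of_ne hij,
          Pi.single_eq_of_ne hij.symm, add_zero, zero_add, h v hv]
        generalize v.2 j = t
        revert t
        decide
      · rintro k ⟨h1, h2⟩
        simp [h1, h2]
    · intro heq
      rw [heq, hammingDist_self] at hdist
      omega

end Perfect

section Doubling

/-- Doubling in an additive commutative group. -/
abbrev dbl (A : Type*) [AddCommMonoid A] : A →+ A := nsmulAddMonoidHom 2

variable {A : Type*} [AddCommGroup A]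

lemma card_eq_card_torsion_mul_card_double (D : AddSubgroup A) :
    Nat.card D = Nat.card {x : A // x ∈ D ∧ x + x = 0} * Nat.card (D.map (dbl A)) := by
  rw [← AddSubgroup.relIndex_ker, ← AddSubgroup.card_mul_index ((dbl A).ker.addSubgroupOf D)]
  congr 1
  refine Nat.card_congr ((Equiv.subtypeSubtypeEquivSubtypeInter (· ∈ D)
    fun x : A => x + x = 0).symm.trans (Equiv.subtypeEquivRight fun x => ?_)).symm
  rw [AddSubgroup.mem_addSubgroupOf, AddMonoidHom.mem_ker, nsmulAddMonoidHom_apply, two_nsmul]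

lemma card_sup_mul_card_inf (H K : AddSubgroup A) :
    Nat.card ↥(H ⊔ K) * Nat.card ↥(H ⊓ K) = Nat.card H * Nat.card K := by
  have h1 := AddSubgroup.relIndex_mul_relIndex ⊥ K (H ⊔ K) bot_le le_sup_right
  have h2 := AddSubgroup.relIndex_mul_relIndex ⊥ (H ⊓ K) H bot_le inf_le_left
  rw [AddSubgroup.relIndex_sup_right] at h1
  rw [AddSubgroup.inf_relIndex_left] at h2
  simp only [AddSubgroup.relIndex_bot_left] at h1 h2
  rw [← h1, ← h2]
  ring

lemma isOfType_of_card {α β γ δ : ℕ} {D : AddSubgroup (Amb α β)}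
    (h : Nat.card D = 2 ^ (γ + 2 * δ)) (h2 : Nat.card (D.map (dbl _)) = 2 ^ δ) :
    isOfType D γ δ := by
  refine ⟨h, ?_⟩
  have := card_eq_card_torsion_mul_card_double D
  rw [h, h2] at this
  refine Nat.eq_of_mul_eq_mul_right (pow_pos two_pos δ) (this.symm.trans ?_)
  ring

lemma map_dbl_map {A' : Type*} [AddCommGroup A'] (f : A →+ A') (P : AddSubgroup A) :
    (P.map f).map (dbl A') = (P.map (dbl A)).map f := by
  rw [AddSubgroup.map_map, AddSubgroup.map_map]
  congr 1
  ext x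
  simp

end Doubling

section BitFunctions

variable {B : Type} [Fintype B]

/-- The value in `Z₄` of a bit. -/
def bit (b : Bool) : Z4 := if b then 1 else 0

/-- The function `x ↦ w.1 + ∑ k, w.2 k * x k` on bit vectors. -/
def evalBits (w : Z4 × (B → Z4)) (x : B → Bool) : Z4 := w.1 + ∑ k, w.2 k * bit (x k)

lemma evalBits_add (w w' : Z4 × (B → Z4)) (x : B → Bool) :
    evalBits (w + w') x = evalBits w x + evalBits w' x := by
  simp only [evalBits, Prod.fst_add, Prod.snd_add, Pi.add_apply, add_mul, Finset.sum_add_distrib]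
  ring

/-- The codeword of values of `evalBits w`, for an enumeration `φ` of the bit vectors. -/
def embedBits {N : ℕ} (φ : Fin N ≃ (B → Bool)) : Z4 × (B → Z4) →+ Amb 0 N where
  toFun w := (0, fun j => evalBits w (φ j))
  map_zero' := by ext j <;> simp [evalBits]
  map_add' w w' := Prod.ext (Subsingleton.elim _ _) (funext fun _ => evalBits_add w w' _)

lemma embedBits_snd {N : ℕ} (φ : Fin N ≃ (B → Bool)) (w : Z4 × (B → Z4)) (j : Fin N) :
    (embedBits φ w).2 j = evalBits w (φ j) := rfl

lemma evalBits_zero (w : Z4 × (B → Z4)) : evalBits w (fun _ => false) = w.1 := by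
  simp [evalBits, bit]

variable [DecidableEq B]

/-- The bit vector whose only nonzero entry is at `k`. -/
def unitBits (k : B) : B → Bool := Pi.single k true

lemma evalBits_unitBits (w : Z4 × (B → Z4)) (k : B) : evalBits w (unitBits k) = w.1 + w.2 k := by
  rw [evalBits, Finset.sum_eq_single k]
  · simp [unitBits, bit]
  · intro b _ hb
    simp [unitBits, bit, Pi.single_eq_of_ne hb]
  · simp

lemma evalBits_toggle_ne {w : Z4 × (B → Z4)} {k : B} (h : w.2 k ≠ 0) (x : B → Bool) :
    evalBits w (Function.update x k (!x k)) ≠ evalBits w x := by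
  intro heq
  simp only [evalBits, ← Finset.add_sum_erase _ _ (Finset.mem_univ k), add_right_inj] at heq
  rw [Finset.sum_congr rfl fun b hb => by
    rw [Function.update_of_ne (Finset.ne_of_mem_erase hb)], add_left_inj,
    Function.update_self] at heq
  generalize w.2 k = a, x k = b at h heq
  revert a b
  decide

lemma eq_zero_of_evalBits_eq_zero {w : Z4 × (B → Z4)} {T : Finset (B → Bool)}
    (hT : 2 * T.card < 2 ^ Fintype.card B) (h : ∀ x ∉ T, evalBits w x = 0) : w = 0 := by
  have hcard : T.card < Tᶜ.card := by
    have := T.card_add_card_compl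
    rw [Fintype.card_fun, Fintype.card_bool] at this
    omega
  have h2 : w.2 = 0 := by
    ext k
    by_contra hk
    have htog (x : B → Bool) :
        Function.update (Function.update x k (!x k)) k (!(Function.update x k (!x k) k)) = x := by
      simp
    refine hcard.not_ge (Finset.card_le_card_of_injOn (fun x => Function.update x k (!x k))
      (fun x hx => ?_) fun x _ y _ hxy => ?_)
    · by_contra hx'
      have hx : x ∉ T := by simpa using hx
      exact evalBits_toggle_ne hk x ((h _ hx').trans (h x hx).symm)
    · dsimp only at hxy
      rw [← htog x, hxy, htog y]
  obtain ⟨x, hx⟩ : Tᶜ.Nonempty := Finset.card_pos.1 (by omega)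
  have h1 := h x (by simpa using hx)
  rw [evalBits, h2] at h1
  exact Prod.ext (by simpa using h1) h2

lemma embedBits_injective {N : ℕ} (φ : Fin N ≃ (B → Bool)) :
    Function.Injective (embedBits φ) := by
  rw [injective_iff_map_eq_zero]
  intro w hw
  refine eq_zero_of_evalBits_eq_zero (T := ∅) (by simp) fun x _ => ?_
  rw [← φ.apply_symm_apply x, ← embedBits_snd, hw]
  rfl

/-- The coefficient vectors vanishing at all indices in `S`. -/
def killed (S : Finset B) : AddSubgroup (Z4 × (B → Z4)) where
  carrier := {w | ∀ k ∈ S, w.2 k = 0}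
  zero_mem' := fun _ _ => rfl
  add_mem' := fun ha hb k hk => by simp [ha k hk, hb k hk]
  neg_mem' := fun ha k hk => by simp [ha k hk]

/-- The zero bit vector together with the unit bit vectors indexed by `S`. -/
def starBits (S : Finset B) : Finset (B → Bool) := insert (fun _ => false) (S.image unitBits)

lemma card_starBits_le (S : Finset B) : (starBits S).card ≤ S.card + 1 :=
  (Finset.card_insert_le _ _).trans (Nat.add_le_add_right Finset.card_image_le 1)

lemma map_embedBits_inf_map {N : ℕ} (φ : Fin N ≃ (B → Bool)) {S : Finset B}
    (hS : 2 * (starBits S).card < 2 ^ Fintype.card B) {σ : Equiv.Perm (B → Bool)}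
    (hσ : σ.IsCycleOn (starBits S)) (hsupp : σ.support ⊆ starBits S)
    (P Q : AddSubgroup (Z4 × (B → Z4))) :
    P.map (embedBits φ) ⊓ Q.map (embedBits (φ.trans σ)) =
      (P ⊓ Q ⊓ killed S).map (embedBits φ) := by
  have hfix {x} (hx : x ∉ starBits S) : σ x = x := by
    by_contra h
    exact hx (hsupp (Equiv.Perm.mem_support.2 h))
  ext u
  constructor
  · rintro ⟨⟨w, hw, rfl⟩, ⟨w', hw', heq⟩⟩
    have hval (x) : evalBits w' (σ x) = evalBits w x := by
      have := congrArg (fun v => v.2 (φ.symm x)) heq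
      simpa [embedBits_snd] using this
    have hww : w' - w = 0 := by
      refine eq_zero_of_evalBits_eq_zero hS fun x hx => ?_
      have h1 := evalBits_add (w' - w) w x
      rw [sub_add_cancel] at h1
      have h2 := hval x
      rw [hfix hx, h1] at h2
      simpa using h2
    obtain rfl := sub_eq_zero.1 hww
    refine ⟨w', ⟨⟨hw, hw'⟩, fun k hk => ?_⟩, rfl⟩
    have hpow (n : ℕ) (x) : evalBits w' ((σ ^ n) x) = evalBits w' x := by
      induction n with
      | zero => simp
      | succ n ih => rw [pow_succ', Equiv.Perm.mul_apply, hval, ih]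
    obtain ⟨n, -, hn⟩ := hσ.exists_pow_eq (Finset.mem_insert_self _ _ : _ ∈ starBits S)
      (Finset.mem_insert_of_mem (Finset.mem_image_of_mem unitBits hk))
    have h := hpow n (fun _ => false)
    rw [hn, evalBits_unitBits, evalBits_zero] at h
    simpa using h
  · rintro ⟨w, ⟨⟨hP, hQ⟩, hk⟩, rfl⟩
    refine ⟨⟨w, hP, rfl⟩, ⟨w, hQ, ?_⟩⟩
    have h_star {x} (hx : x ∈ starBits S) : evalBits w x = w.1 := by
      rcases Finset.mem_insert.1 hx with rfl | hx
      · exact evalBits_zero w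
      · obtain ⟨k, hkS, rfl⟩ := Finset.mem_image.1 hx
        rw [evalBits_unitBits, hk k hkS, add_zero]
    refine Prod.ext rfl (funext fun j => ?_)
    rw [embedBits_snd, embedBits_snd, Equiv.trans_apply]
    by_cases hx : φ j ∈ starBits S
    · rw [h_star hx, h_star (hσ.apply_mem_iff.2 hx)]
    · rw [hfix hx]

/-- The conditions on a group of coefficient vectors under which the codewords it gives
generate the dual of a quaternary linear perfect code. -/
structure IsPerfectDual (m : ℕ) (P : AddSubgroup (Z4 × (B → Z4))) : Prop where
  card_eq : Nat.card P = 2 ^ (2 * m + 2)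
  one_mem : (1, 0) ∈ P
  separates : ∀ x y, (∀ w ∈ P, evalBits w x = evalBits w y) → x = y
  exists_even : ∃ k, ∀ w ∈ P, 2 * w.2 k = 0

lemma IsPerfectDual.isQuatPerfect {m : ℕ} (hm : 2 ≤ m) {P : AddSubgroup (Z4 × (B → Z4))}
    (h : IsPerfectDual m P) (φ : Fin (2 ^ (2 * m)) ≃ (B → Bool)) :
    isQuatPerfect (2 * m + 1) (2 ^ (2 * m)) (dualCode (P.map (embedBits φ))) := by
  refine isQuatPerfect_dualCode hm ?_ ⟨_, h.one_mem, ?_⟩ (fun i j hij => ?_) ?_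
  · rw [AddSubgroup.card_map_of_injective (embedBits_injective φ), h.card_eq]
  · refine Prod.ext rfl (funext fun j => ?_)
    simp [embedBits_snd, evalBits]
  · by_contra! hcon
    exact hij (φ.injective (h.separates _ _ fun w hw => hcon _ ⟨w, hw, rfl⟩))
  · obtain ⟨k, hk⟩ := h.exists_even
    refine ⟨φ.symm (fun _ => false), φ.symm (unitBits k), fun heq => ?_, ?_⟩
    · have := congrFun (φ.symm.injective heq) k
      simp [unitBits] at this
    · rintro _ ⟨w, hw, rfl⟩
      simp only [embedBits_snd, Equiv.apply_symm_apply, evalBits_zero, evalBits_unitBits]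
      rw [mul_add, hk w hw, add_zero]

lemma exists_codes {m γ₁ δ₁ γ₂ δ₂ γ δ i b : ℕ} (hm : 2 ≤ m) (hB : Fintype.card B = 2 * m)
    {P Q : AddSubgroup (Z4 × (B → Z4))} (hP : IsPerfectDual m P) (hQ : IsPerfectDual m Q)
    (hP2 : Nat.card (P.map (dbl _)) = 2 ^ δ₁) (hQ2 : Nat.card (Q.map (dbl _)) = 2 ^ δ₂)
    {S : Finset B} (hS : S.card ≤ m)
    (hi : Nat.card ↥(P ⊓ Q ⊓ killed S) = 2 ^ i)
    (hb : Nat.card ↥(P.map (dbl _) ⊓ Q.map (dbl _) ⊓ killed S) = 2 ^ b)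
    (h₁ : γ₁ + 2 * δ₁ = 2 * m + 2) (h₂ : γ₂ + 2 * δ₂ = 2 * m + 2)
    (hδ : δ + b = δ₁ + δ₂) (hγ : γ + 2 * δ + i = 4 * m + 4) :
    ∃ C₁ C₂ : AddSubgroup (Amb 0 (2 ^ (2 * m))),
      isQuatPerfect (2 * m + 1) (2 ^ (2 * m)) C₁ ∧
      isQuatPerfect (2 * m + 1) (2 ^ (2 * m)) C₂ ∧
      isOfType (dualCode C₁) γ₁ δ₁ ∧ isOfType (dualCode C₂) γ₂ δ₂ ∧
      isOfType (dualCode (C₁ ⊓ C₂)) γ δ := by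
  have φ : Fin (2 ^ (2 * m)) ≃ (B → Bool) := (Fintype.equivFinOfCardEq (by simp [hB])).symm
  obtain ⟨σ, hσ, hsupp⟩ := (starBits S).exists_cycleOn
  have hsmall : 2 * (starBits S).card < 2 ^ Fintype.card B := by
    have h1 := card_starBits_le S
    have h2 : m < 2 ^ m := Nat.lt_two_pow_self
    have h3 : 2 ^ 2 ≤ 2 ^ m := Nat.pow_le_pow_right two_pos hm
    rw [hB, two_mul m, pow_add]
    nlinarith
  have hinj := embedBits_injective φ
  have hinj' := embedBits_injective (φ.trans σ)
  refine ⟨dualCode (P.map (embedBits φ)), dualCode (Q.map (embedBits (φ.trans σ))),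
    hP.isQuatPerfect hm φ, hQ.isQuatPerfect hm _, ?_, ?_, ?_⟩
  · rw [dualCode_dualCode]
    refine isOfType_of_card ?_ ?_
    · rw [AddSubgroup.card_map_of_injective hinj, hP.card_eq, h₁]
    · rw [map_dbl_map, AddSubgroup.card_map_of_injective hinj, hP2]
  · rw [dualCode_dualCode]
    refine isOfType_of_card ?_ ?_
    · rw [AddSubgroup.card_map_of_injective hinj', hQ.card_eq, h₂]
    · rw [map_dbl_map, AddSubgroup.card_map_of_injective hinj', hQ2]
  · rw [dualCode_inf_dualCode, dualCode_dualCode]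
    refine isOfType_of_card ?_ ?_
    · have h := card_sup_mul_card_inf (P.map (embedBits φ)) (Q.map (embedBits (φ.trans σ)))
      rw [map_embedBits_inf_map φ hsmall hσ hsupp, AddSubgroup.card_map_of_injective hinj,
        AddSubgroup.card_map_of_injective hinj, AddSubgroup.card_map_of_injective hinj',
        hi, hP.card_eq, hQ.card_eq] at h
      refine Nat.eq_of_mul_eq_mul_right (pow_pos two_pos i) (h.trans ?_)
      rw [← pow_add, ← pow_add, hγ]
      congr 1
      ring
    · rw [AddSubgroup.map_sup, map_dbl_map, map_dbl_map]
      have h := card_sup_mul_card_inf ((P.map (dbl _)).map (embedBits φ))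
        ((Q.map (dbl _)).map (embedBits (φ.trans σ)))
      rw [map_embedBits_inf_map φ hsmall hσ hsupp, AddSubgroup.card_map_of_injective hinj,
        AddSubgroup.card_map_of_injective hinj, AddSubgroup.card_map_of_injective hinj',
        hb, hP2, hQ2] at h
      refine Nat.eq_of_mul_eq_mul_right (pow_pos two_pos b) (h.trans ?_)
      rw [← pow_add, ← pow_add, hδ]

end BitFunctions

section Glue

variable {J : Type} {n : J → ℕ}

/-- The coefficient vectors with constant term in `A₀` and `j`-th block in `A j`. -/
def glue (A₀ : AddSubgroup Z4) (A : ∀ j, AddSubgroup (Fin (n j) → Z4)) :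
    AddSubgroup (Z4 × ((Σ j, Fin (n j)) → Z4)) where
  carrier := {w | w.1 ∈ A₀ ∧ ∀ j, (fun i => w.2 ⟨j, i⟩) ∈ A j}
  zero_mem' := ⟨A₀.zero_mem, fun j => (A j).zero_mem⟩
  add_mem' := fun ha hb => ⟨A₀.add_mem ha.1 hb.1, fun j => (A j).add_mem (ha.2 j) (hb.2 j)⟩
  neg_mem' := fun ha => ⟨A₀.neg_mem ha.1, fun j => (A j).neg_mem (ha.2 j)⟩

lemma mem_glue {A₀ : AddSubgroup Z4} {A : ∀ j, AddSubgroup (Fin (n j) → Z4)}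
    {w : Z4 × ((Σ j, Fin (n j)) → Z4)} :
    w ∈ glue A₀ A ↔ w.1 ∈ A₀ ∧ ∀ j, (fun i => w.2 ⟨j, i⟩) ∈ A j := Iff.rfl

lemma glue_inf_glue (A₀ A₀' : AddSubgroup Z4) (A A' : ∀ j, AddSubgroup (Fin (n j) → Z4)) :
    glue A₀ A ⊓ glue A₀' A' = glue (A₀ ⊓ A₀') fun j => A j ⊓ A' j := by
  ext w
  simp only [AddSubgroup.mem_inf, mem_glue, forall_and]
  tauto

lemma map_dbl_glue (A₀ : AddSubgroup Z4) (A : ∀ j, AddSubgroup (Fin (n j) → Z4)) :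
    (glue A₀ A).map (dbl _) = glue (A₀.map (dbl _)) fun j => (A j).map (dbl _) := by
  ext w
  constructor
  · rintro ⟨v, hv, rfl⟩
    exact ⟨⟨v.1, hv.1, rfl⟩, fun j => ⟨_, hv.2 j, rfl⟩⟩
  · rintro ⟨⟨c, hc, hcw⟩, hA⟩
    choose v hv hvw using hA
    refine ⟨(c, fun k => v k.1 k.2), ⟨hc, hv⟩, Prod.ext hcw (funext fun k => ?_)⟩
    exact congrFun (hvw k.1) k.2

lemma card_glue [Fintype J] (A₀ : AddSubgroup Z4) (A : ∀ j, AddSubgroup (Fin (n j) → Z4)) :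
    Nat.card (glue A₀ A) = Nat.card A₀ * ∏ j, Nat.card (A j) := by
  rw [← Nat.card_pi, ← Nat.card_prod]
  exact Nat.card_congr
    { toFun := fun w => (⟨w.1.1, w.2.1⟩, fun j => ⟨_, w.2.2 j⟩)
      invFun := fun p => ⟨(p.1.1, fun k => (p.2 k.1).1 k.2), p.1.2, fun j => (p.2 j).2⟩
      left_inv := fun _ => rfl
      right_inv := fun _ => rfl }

lemma card_glue_of_card [Fintype J] {A₀ : AddSubgroup Z4}
    {A : ∀ j, AddSubgroup (Fin (n j) → Z4)} {a₀ : ℕ} {a : J → ℕ} (h₀ : Nat.card A₀ = 2 ^ a₀)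
    (h : ∀ j, Nat.card (A j) = 2 ^ a j) : Nat.card (glue A₀ A) = 2 ^ (a₀ + ∑ j, a j) := by
  rw [card_glue, h₀, Finset.prod_congr rfl fun j _ => h j, Finset.prod_pow_eq_pow_sum, pow_add]

/-- The vectors in one block vanishing at all indices in `K`. -/
def killedBlock {k : ℕ} (K : Finset (Fin k)) : AddSubgroup (Fin k → Z4) where
  carrier := {x | ∀ i ∈ K, x i = 0}
  zero_mem' := fun _ _ => rfl
  add_mem' := fun ha hb i hi => by simp [ha i hi, hb i hi]
  neg_mem' := fun ha i hi => by simp [ha i hi]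

lemma killed_sigma [Fintype J] (K : ∀ j, Finset (Fin (n j))) :
    killed (Finset.univ.sigma K) = glue ⊤ fun j => killedBlock (K j) := by
  ext w
  refine ⟨fun h => ⟨trivial, fun j i hi => h ⟨j, i⟩ (by simpa using hi)⟩, fun h k hk => ?_⟩
  exact h.2 k.1 k.2 (Finset.mem_sigma.1 hk).2

/-- Evaluation of a linear form at a bit vector, within one block. -/
def evalBlock {k : ℕ} (a : Fin k → Z4) (x : Fin k → Bool) : Z4 := ∑ i, a i * bit (x i)

/-- A pair of groups of coefficient vectors on `2 * r` bits, together with a set of bits on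
which a permutation of the coordinates forces the common coefficients to vanish. -/
structure Block where
  r : ℕ
  P : AddSubgroup (Fin (2 * r) → Z4)
  Q : AddSubgroup (Fin (2 * r) → Z4)
  K : Finset (Fin (2 * r))
  p : ℕ
  i : ℕ
  b : ℕ
  card_P : Nat.card P = 2 ^ (2 * r)
  card_Q : Nat.card Q = 2 ^ (2 * r)
  card_double_P : Nat.card (P.map (dbl _)) = 2 ^ p
  card_double_Q : Nat.card (Q.map (dbl _)) = 2 ^ r
  card_inf : Nat.card ↥(P ⊓ Q ⊓ killedBlock K) = 2 ^ i
  card_double_inf : Nat.card ↥(P.map (dbl _) ⊓ Q.map (dbl _) ⊓ killedBlock K) = 2 ^ b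
  card_K : K.card ≤ r
  separates_P : ∀ x y, (∀ a ∈ P, evalBlock a x = evalBlock a y) → x = y
  separates_Q : ∀ x y, (∀ a ∈ Q, evalBlock a x = evalBlock a y) → x = y
  exists_even_P : ∃ k, ∀ a ∈ P, 2 * a k = 0
  exists_even_Q : ∃ k, ∀ a ∈ Q, 2 * a k = 0

lemma isPerfectDual_glue [Fintype J] [DecidableEq J] [Nonempty J] {m : ℕ}
    {A : ∀ j, AddSubgroup (Fin (n j) → Z4)} (hn : ∑ j, n j = 2 * m)
    (hcard : ∀ j, Nat.card (A j) = 2 ^ n j)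
    (hsep : ∀ j x y, (∀ a ∈ A j, evalBlock a x = evalBlock a y) → x = y)
    (heven : ∀ j, ∃ k, ∀ a ∈ A j, 2 * a k = 0) :
    IsPerfectDual m (glue ⊤ A) where
  card_eq := by
    rw [card_glue_of_card (a₀ := 2) (by simp) hcard, hn, add_comm]
  one_mem := ⟨trivial, fun j => (A j).zero_mem⟩
  separates x y h := by
    have hj (j) : (fun i => x ⟨j, i⟩) = fun i => y ⟨j, i⟩ := by
      refine hsep j _ _ fun a ha => ?_
      let v : ∀ j, Fin (n j) → Z4 := Pi.single j a
      have heval (z : (Σ j, Fin (n j)) → Bool) :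
          evalBits (0, fun k : Σ j, Fin (n j) => v k.1 k.2) z =
            evalBlock a fun i => z ⟨j, i⟩ := by
        rw [evalBits, evalBlock, Fintype.sum_sigma, Finset.sum_eq_single j]
        · simp [v]
        · intro j' _ hj'
          simp [v, Pi.single_eq_of_ne hj']
        · simp
      rw [← heval, ← heval]
      refine h _ ⟨trivial, fun j' => ?_⟩
      by_cases hj' : j' = j
      · subst hj'
        simpa [v] using ha
      · simp only [v, Pi.single_eq_of_ne hj']
        exact (A j').zero_mem
    exact funext fun k => congrFun (hj k.1) k.2
  exists_even := by
    obtain ⟨j⟩ := ‹Nonempty J›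
    obtain ⟨k, hk⟩ := heven j
    exact ⟨⟨j, k⟩, fun w hw => hk _ (hw.2 j)⟩

lemma exists_codes_of_blocks [Fintype J] [DecidableEq J] (β : J → Block)
    {m γ₁ δ₁ γ δ : ℕ} (hm : 2 ≤ m) (hr : ∑ j, (β j).r = m)
    (h₁ : γ₁ + 2 * δ₁ = 2 * m + 2) (hp : ∑ j, (β j).p + 1 = δ₁)
    (hδ : δ + ∑ j, (β j).b = δ₁ + m) (hγ : γ + 2 * δ + ∑ j, (β j).i = 4 * m + 2) :
    ∃ C₁ C₂ : AddSubgroup (Amb 0 (2 ^ (2 * m))),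
      isQuatPerfect (2 * m + 1) (2 ^ (2 * m)) C₁ ∧
      isQuatPerfect (2 * m + 1) (2 ^ (2 * m)) C₂ ∧
      isOfType (dualCode C₁) γ₁ δ₁ ∧ isOfType (dualCode C₂) 0 (m + 1) ∧
      isOfType (dualCode (C₁ ⊓ C₂)) γ δ := by
  have hne : Nonempty J := by
    by_contra h
    rw [not_nonempty_iff] at h
    simp at hr
    omega
  have hn : ∑ j, 2 * (β j).r = 2 * m := by rw [← Finset.mul_sum, hr]
  have htop : Nat.card (⊤ : AddSubgroup Z4) = 2 ^ 2 := by simp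
  have htwo : Nat.card ((⊤ : AddSubgroup Z4).map (dbl _)) = 2 ^ 1 := by
    have h := card_eq_card_torsion_mul_card_double (⊤ : AddSubgroup Z4)
    have h2 : Nat.card {x : Z4 // x ∈ (⊤ : AddSubgroup Z4) ∧ x + x = 0} = 2 := by
      simp only [AddSubgroup.mem_top, true_and]
      rw [Nat.card_eq_fintype_card]
      decide
    rw [h2, htop] at h
    omega
  refine exists_codes (B := Σ j, Fin (2 * (β j).r)) (P := glue ⊤ fun j => (β j).P)
    (Q := glue ⊤ fun j => (β j).Q) (S := Finset.univ.sigma fun j => (β j).K) hm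
    (by simpa using hn)
    (isPerfectDual_glue hn (fun j => (β j).card_P) (fun j => (β j).separates_P)
      fun j => (β j).exists_even_P)
    (isPerfectDual_glue hn (fun j => (β j).card_Q) (fun j => (β j).separates_Q)
      fun j => (β j).exists_even_Q) (i := 2 + ∑ j, (β j).i) (b := 1 + ∑ j, (β j).b)
    ?_ ?_ ?_ ?_ ?_ h₁ (by ring) (by omega) (by omega)
  · rw [map_dbl_glue, card_glue_of_card htwo fun j => (β j).card_double_P, add_comm, hp]
  · rw [map_dbl_glue, card_glue_of_card htwo fun j => (β j).card_double_Q, add_comm, hr]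
  · rw [Finset.card_sigma, ← hr]
    exact Finset.sum_le_sum fun j _ => (β j).card_K
  · rw [glue_inf_glue, killed_sigma, glue_inf_glue]
    simp only [le_refl, inf_of_le_left]
    exact card_glue_of_card htop fun j => (β j).card_inf
  · rw [map_dbl_glue, map_dbl_glue, glue_inf_glue, killed_sigma, glue_inf_glue]
    simp only [le_refl, le_top, inf_of_le_left]
    exact card_glue_of_card htwo fun j => (β j).card_double_inf

end Glue

section Blocks

/-- The vectors annihilated by all the rows in `L`. -/
def nullspace {k : ℕ} (L : List (Fin k → Z4)) : AddSubgroup (Fin k → Z4) where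
  carrier := {x | ∀ l ∈ L, l ⬝ᵥ x = 0}
  zero_mem' := fun l _ => dotProduct_zero l
  add_mem' := fun ha hb l hl => by rw [dotProduct_add, ha l hl, hb l hl, add_zero]
  neg_mem' := fun ha l hl => by rw [dotProduct_neg, ha l hl, neg_zero]

instance {k : ℕ} (L : List (Fin k → Z4)) : DecidablePred (· ∈ nullspace L) :=
  fun x => inferInstanceAs (Decidable (∀ l ∈ L, l ⬝ᵥ x = 0))

lemma card_nullspace {k : ℕ} (L : List (Fin k → Z4)) :
    Nat.card (nullspace L) = (Finset.univ.filter (· ∈ nullspace L)).card := by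
  rw [Nat.card_eq_fintype_card, Fintype.card_subtype]

lemma map_dbl_nullspace {k : ℕ} (L L' : List (Fin k → Z4))
    (h : ∀ x ∈ nullspace L, 2 • x ∈ nullspace L')
    (h' : ∀ x ∈ nullspace L', ∃ y ∈ nullspace L, 2 • y = x) :
    (nullspace L).map (dbl _) = nullspace L' := by
  ext x
  constructor
  · rintro ⟨y, hy, rfl⟩
    exact h y hy
  · intro hx
    obtain ⟨y, hy, hyx⟩ := h' x hx
    exact ⟨y, hy, hyx⟩

/-- A block all of whose groups are given by equations: `P` and `Q` by `LP` and `LQ`, their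
doubles by `LP₂` and `LQ₂`, and the two intersections by `LI` and `LI₂`. -/
def Block.ofNullspaces (r p i b : ℕ) (LP LQ LP₂ LQ₂ LI LI₂ : List (Fin (2 * r) → Z4))
    (K : Finset (Fin (2 * r)))
    (card_P : (Finset.univ.filter (· ∈ nullspace LP)).card = 2 ^ (2 * r))
    (card_Q : (Finset.univ.filter (· ∈ nullspace LQ)).card = 2 ^ (2 * r))
    (card_P₂ : (Finset.univ.filter (· ∈ nullspace LP₂)).card = 2 ^ p)
    (card_Q₂ : (Finset.univ.filter (· ∈ nullspace LQ₂)).card = 2 ^ r)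
    (card_I : (Finset.univ.filter (· ∈ nullspace LI)).card = 2 ^ i)
    (card_I₂ : (Finset.univ.filter (· ∈ nullspace LI₂)).card = 2 ^ b)
    (double_P : ∀ x ∈ nullspace LP, 2 • x ∈ nullspace LP₂)
    (double_P' : ∀ x ∈ nullspace LP₂, ∃ y ∈ nullspace LP, 2 • y = x)
    (double_Q : ∀ x ∈ nullspace LQ, 2 • x ∈ nullspace LQ₂)
    (double_Q' : ∀ x ∈ nullspace LQ₂, ∃ y ∈ nullspace LQ, 2 • y = x)
    (mem_I : ∀ x, (x ∈ nullspace LP ∧ x ∈ nullspace LQ) ∧ (∀ i ∈ K, x i = 0) ↔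
      x ∈ nullspace LI)
    (mem_I₂ : ∀ x, (x ∈ nullspace LP₂ ∧ x ∈ nullspace LQ₂) ∧ (∀ i ∈ K, x i = 0) ↔
      x ∈ nullspace LI₂)
    (card_K : K.card ≤ r)
    (separates_P : ∀ x y, (∀ a ∈ nullspace LP, evalBlock a x = evalBlock a y) → x = y)
    (separates_Q : ∀ x y, (∀ a ∈ nullspace LQ, evalBlock a x = evalBlock a y) → x = y)
    (exists_even_P : ∃ k, ∀ a ∈ nullspace LP, 2 * a k = 0)
    (exists_even_Q : ∃ k, ∀ a ∈ nullspace LQ, 2 * a k = 0) : Block where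
  r := r
  P := nullspace LP
  Q := nullspace LQ
  K := K
  p := p
  i := i
  b := b
  card_P := (card_nullspace LP).trans card_P
  card_Q := (card_nullspace LQ).trans card_Q
  card_double_P := by
    rw [map_dbl_nullspace LP LP₂ double_P double_P', card_nullspace, card_P₂]
  card_double_Q := by
    rw [map_dbl_nullspace LQ LQ₂ double_Q double_Q', card_nullspace, card_Q₂]
  card_inf := by
    rw [show nullspace LP ⊓ nullspace LQ ⊓ killedBlock K = nullspace LI from AddSubgroup.ext mem_I, card_nullspace, card_I]
  card_double_inf := by
    rw [map_dbl_nullspace LP LP₂ double_P double_P', map_dbl_nullspace LQ LQ₂ double_Q double_Q',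
      show nullspace LP₂ ⊓ nullspace LQ₂ ⊓ killedBlock K = nullspace LI₂ from
        AddSubgroup.ext mem_I₂, card_nullspace, card_I₂]
  card_K := card_K
  separates_P := separates_P
  separates_Q := separates_Q
  exists_even_P := exists_even_P
  exists_even_Q := exists_even_Q

set_option maxHeartbeats 4000000 in
/-- The pair `Z₄ × Z₂²`, `Z₄²` meeting in the double of the second group. -/
def crossedBlock : Block :=
  Block.ofNullspaces 2 1 2 0
    [![2, 0, 0, 0], ![0, 2, 0, 0], ![0, 0, 2, 3]]
    [![2, 0, 3, 0], ![0, 2, 0, 3]]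
    [![1, 0, 0, 0], ![0, 1, 0, 0], ![0, 0, 2, 0], ![0, 0, 0, 1]]
    [![2, 0, 0, 0], ![0, 2, 0, 0], ![0, 0, 1, 0], ![0, 0, 0, 1]]
    [![2, 0, 0, 0], ![0, 2, 0, 0], ![0, 0, 1, 0], ![0, 0, 0, 1]]
    [![1, 0, 0, 0], ![0, 1, 0, 0], ![0, 0, 1, 0], ![0, 0, 0, 1]]
    ∅
    (by decide +kernel) (by decide +kernel) (by decide +kernel) (by decide +kernel)
    (by decide +kernel) (by decide +kernel) (by decide +kernel) (by decide +kernel)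
    (by decide +kernel) (by decide +kernel) (by decide +kernel) (by decide +kernel)
    (by decide +kernel) (by decide +kernel) (by decide +kernel) (by decide +kernel)
    (by decide +kernel)

/-- The pair `Z₄`, `Z₄` meeting trivially. -/
def swappedBlock : Block :=
  Block.ofNullspaces 1 1 0 0
    [![2, 3]]
    [![3, 2]]
    [![2, 0], ![0, 1]]
    [![1, 0], ![0, 2]]
    [![1, 0], ![0, 1]]
    [![1, 0], ![0, 1]]
    ∅
    (by decide +kernel) (by decide +kernel) (by decide +kernel) (by decide +kernel)
    (by decide +kernel) (by decide +kernel) (by decide +kernel) (by decide +kernel)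
    (by decide +kernel) (by decide +kernel) (by decide +kernel) (by decide +kernel)
    (by decide +kernel) (by decide +kernel) (by decide +kernel) (by decide +kernel)
    (by decide +kernel)

/-- The pair `Z₄`, `Z₄` of equal groups. -/
def equalBlock : Block :=
  Block.ofNullspaces 1 1 2 1
    [![2, 3]]
    [![2, 3]]
    [![2, 0], ![0, 1]]
    [![2, 0], ![0, 1]]
    [![2, 3]]
    [![2, 0], ![0, 1]]
    ∅
    (by decide +kernel) (by decide +kernel) (by decide +kernel) (by decide +kernel)
    (by decide +kernel) (by decide +kernel) (by decide +kernel) (by decide +kernel)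
    (by decide +kernel) (by decide +kernel) (by decide +kernel) (by decide +kernel)
    (by decide +kernel) (by decide +kernel) (by decide +kernel) (by decide +kernel)
    (by decide +kernel)

/-- The pair `Z₄`, `Z₄` of equal groups, permuted so as to meet only in the doubles. -/
def equalKilledBlock : Block :=
  Block.ofNullspaces 1 1 1 1
    [![2, 3]]
    [![2, 3]]
    [![2, 0], ![0, 1]]
    [![2, 0], ![0, 1]]
    [![2, 0], ![0, 1]]
    [![2, 0], ![0, 1]]
    {1}
    (by decide +kernel) (by decide +kernel) (by decide +kernel) (by decide +kernel)
    (by decide +kernel) (by decide +kernel) (by decide +kernel) (by decide +kernel)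
    (by decide +kernel) (by decide +kernel) (by decide +kernel) (by decide +kernel)
    (by decide +kernel) (by decide +kernel) (by decide +kernel) (by decide +kernel)
    (by decide +kernel)

/-- The pair `Z₂²`, `Z₄` meeting in the double of the second group. -/
def mixedBlock : Block :=
  Block.ofNullspaces 1 0 1 0
    [![2, 0], ![0, 2]]
    [![2, 3]]
    [![1, 0], ![0, 1]]
    [![2, 0], ![0, 1]]
    [![2, 0], ![0, 1]]
    [![1, 0], ![0, 1]]
    ∅
    (by decide +kernel) (by decide +kernel) (by decide +kernel) (by decide +kernel)
    (by decide +kernel) (by decide +kernel) (by decide +kernel) (by decide +kernel)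
    (by decide +kernel) (by decide +kernel) (by decide +kernel) (by decide +kernel)
    (by decide +kernel) (by decide +kernel) (by decide +kernel) (by decide +kernel)
    (by decide +kernel)

/-- The pair `Z₂²`, `Z₄`, permuted so as to meet trivially. -/
def mixedKilledBlock : Block :=
  Block.ofNullspaces 1 0 0 0
    [![2, 0], ![0, 2]]
    [![2, 3]]
    [![1, 0], ![0, 1]]
    [![2, 0], ![0, 1]]
    [![1, 0], ![0, 1]]
    [![1, 0], ![0, 1]]
    {0}
    (by decide +kernel) (by decide +kernel) (by decide +kernel) (by decide +kernel)
    (by decide +kernel) (by decide +kernel) (by decide +kernel) (by decide +kernel)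
    (by decide +kernel) (by decide +kernel) (by decide +kernel) (by decide +kernel)
    (by decide +kernel) (by decide +kernel) (by decide +kernel) (by decide +kernel)
    (by decide +kernel)

/-- The kinds of blocks used in the construction. -/
def blockOfKind : Fin 6 → Block :=
  ![crossedBlock, swappedBlock, equalBlock, equalKilledBlock, mixedBlock, mixedKilledBlock]

lemma sum_blockOfKind (n : Fin 6 → ℕ) (f : Block → ℕ) :
    ∑ j : Σ κ, Fin (n κ), f (blockOfKind j.1) =
      n 0 * f crossedBlock + n 1 * f swappedBlock + n 2 * f equalBlock +
        n 3 * f equalKilledBlock + n 4 * f mixedBlock + n 5 * f mixedKilledBlock := by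
  simp [Fintype.sum_sigma, Fin.sum_univ_six, blockOfKind]

lemma exists_codes_of_block_counts (n : Fin 6 → ℕ) {m γ₁ δ₁ γ δ : ℕ} (hm : 2 ≤ m)
    (hr : 2 * n 0 + n 1 + n 2 + n 3 + n 4 + n 5 = m) (h₁ : γ₁ + 2 * δ₁ = 2 * m + 2)
    (hp : n 0 + n 1 + n 2 + n 3 + 1 = δ₁) (hδ : δ + n 2 + n 3 = δ₁ + m)
    (hγ : γ + 2 * δ + (2 * n 0 + 2 * n 2 + n 3 + n 4) = 4 * m + 2) :
    ∃ C₁ C₂ : AddSubgroup (Amb 0 (2 ^ (2 * m))),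
      isQuatPerfect (2 * m + 1) (2 ^ (2 * m)) C₁ ∧
      isQuatPerfect (2 * m + 1) (2 ^ (2 * m)) C₂ ∧
      isOfType (dualCode C₁) γ₁ δ₁ ∧ isOfType (dualCode C₂) 0 (m + 1) ∧
      isOfType (dualCode (C₁ ⊓ C₂)) γ δ := by
  refine exists_codes_of_blocks (fun j : Σ κ, Fin (n κ) => blockOfKind j.1) hm ?_ h₁ ?_ ?_ ?_
  · rw [sum_blockOfKind n Block.r, ← hr]
    simp only [crossedBlock, swappedBlock, equalBlock, equalKilledBlock, mixedBlock,
      mixedKilledBlock, Block.ofNullspaces]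
    ring
  · rw [sum_blockOfKind n Block.p, ← hp]
    simp only [crossedBlock, swappedBlock, equalBlock, equalKilledBlock, mixedBlock,
      mixedKilledBlock, Block.ofNullspaces]
    ring
  · rw [sum_blockOfKind n Block.b, ← hδ]
    simp only [crossedBlock, swappedBlock, equalBlock, equalKilledBlock, mixedBlock,
      mixedKilledBlock, Block.ofNullspaces]
    ring
  · rw [sum_blockOfKind n Block.i, ← hγ]
    simp only [crossedBlock, swappedBlock, equalBlock, equalKilledBlock, mixedBlock,
      mixedKilledBlock, Block.ofNullspaces]
    ring

end Blocks

/-- existence of quaternary linear perfect codes of length `2^(2m)` of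
dual types `(0,2^(2m);γ₁,δ₁)` and `(0,2^(2m);0,m+1)`, whose intersection attains every
admissible dual type `(0,2^(2m);γ,δ)` (the bounds `max(0, γ₁+δ₁-δ) ≤ γ` and
`γ ≤ γ₁+δ₁-δ+m` are stated in the subtraction-free equivalent forms
`γ₁+δ₁ ≤ γ+δ` and `γ+δ ≤ γ₁+δ₁+m`). -/
theorem stmt11 {m γ₁ δ₁ γ δ : ℕ} (hm : 2 ≤ m) (h1 : γ₁ + 2 * δ₁ = 2 * m + 2)
    (hδ₁ : 1 ≤ δ₁) (hδl : m + 1 ≤ δ) (hδu : δ ≤ δ₁ + m)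
    (hγl : γ₁ + δ₁ ≤ γ + δ) (hγu : γ + δ ≤ γ₁ + δ₁ + m) :
    ∃ C₁ C₂ : AddSubgroup (Amb 0 (2 ^ (2 * m))),
      isQuatPerfect (2 * m + 1) (2 ^ (2 * m)) C₁ ∧
      isQuatPerfect (2 * m + 1) (2 ^ (2 * m)) C₂ ∧
      isOfType (dualCode C₁) γ₁ δ₁ ∧ isOfType (dualCode C₂) 0 (m + 1) ∧
      isOfType (dualCode (C₁ ⊓ C₂)) γ δ := by
  obtain ⟨c, hc⟩ : ∃ c, c + γ + δ + δ₁ = 3 * m + 2 := ⟨3 * m + 2 - (γ + δ + δ₁), by omega⟩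
  obtain ⟨a, rfl⟩ := Nat.exists_eq_add_of_le hδl
  rcases le_total m (c + a) with h | h
  · refine exists_codes_of_block_counts ![c + a - m, m - c, δ₁ - 1 - a, 0,
      2 * m + 1 - δ₁ - (c + a), 0] hm ?_ h1 ?_ ?_ ?_ <;> simp <;> omega
  · have key (t : ℕ) (ht : t = min (m - a - c) (δ₁ - 1 - a)) := exists_codes_of_block_counts
      ![0, a, δ₁ - 1 - a - t, t, m + 1 - δ₁ - (m - a - c - t), m - a - c - t]
      (γ₁ := γ₁) (δ₁ := δ₁) (γ := γ) (δ := m + 1 + a) hm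
    refine key _ rfl ?_ h1 ?_ ?_ ?_ <;> simp <;> omega
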